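/- Let n, k be integers with 1 ≤ k ≤ n. Every (0,n,k)-Gog trapezoid has bottom row (1,2,…,k), and the number of (0,n,k)-Gog trapezoids equals the constant term in x_1,…,x_n of the Laurent polynomial ∏_{i=1}^{k} (1+x_i)^{i} x_i^{−n+1} · ∏_{i=k+1}^{n} (1+x_i)^{k+1} x_i^{−n+i−k} · ∏_{1≤i<j≤n} (x_i − x_j)(1 + x_j + x_i x_j). -/

import Mathlib

open scoped BigOperators

/-- The position `(i,j)` (row `i`, `j`-th entry of the row, both 1-based) belongs to the shape
of an `(m,n,k)`-Gog trapezoid. -/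
def GogPos (n k i j : ℕ) : Prop := 1 ≤ i ∧ i ≤ n ∧ 1 ≤ j ∧ j ≤ i ∧ j ≤ k

/-- An `(m,n,k)`-Gog trapezoid, encoded as `a : ℕ → ℕ → ℤ` (zero off the shape): positive
entries, weak increase along NE- and SE-diagonals, strict increase along rows, and the entries
of the `i`-th SE-diagonal bounded above by `m+i`, i.e. `a i j ≤ m + n − i + j`. -/
def IsGog (m n k : ℕ) (a : ℕ → ℕ → ℤ) : Prop :=
  (∀ i j, GogPos n k i j → 1 ≤ a i j ∧ a i j ≤ ((m + (n - i) + j : ℕ) : ℤ)) ∧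
  (∀ i j, GogPos n k i j → GogPos n k (i+1) j → a (i+1) j ≤ a i j) ∧
  (∀ i j, GogPos n k i j → GogPos n k (i+1) (j+1) → a i j ≤ a (i+1) (j+1)) ∧
  (∀ i j, GogPos n k i j → GogPos n k i (j+1) → a i j < a i (j+1)) ∧
  (∀ i j, ¬ GogPos n k i j → a i j = 0)

/-- The exponent vector with `x_i`-entry `n−1` for `1 ≤ i ≤ k` and `n+k−i` for `k < i ≤ n`. -/
noncomputable def gogDeg (n k : ℕ) : ℕ →₀ ℕ :=
  (∑ i ∈ Finset.Icc 1 k, Finsupp.single i (n-1)) +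
    ∑ i ∈ Finset.Icc (k+1) n, Finsupp.single i (n + k - i)

section GogConstantTerm

open MvPolynomial Finset

/-- The map `ℕ → ℕ` that enumerates the complement of `s`. -/
def skip (s i : ℕ) : ℕ := if i < s then i else i + 1

theorem skip_strictMono (s : ℕ) : StrictMono (skip s) := by
  intro a b h
  unfold skip
  split_ifs <;> omega

theorem skip_ne (s i : ℕ) : skip s i ≠ s := by
  unfold skip
  split_ifs <;> omega

/-- A product over `{1,…,n+1}`, with the factor at `s` split off. -/
theorem prod_Icc_skip {M : Type*} [CommMonoid M] (n s : ℕ) (h1 : 1 ≤ s) (h2 : s ≤ n + 1)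
    (f : ℕ → M) : ∏ i ∈ Icc 1 (n + 1), f i = f s * ∏ i ∈ Icc 1 n, f (skip s i) := by
  have hs : s ∈ Icc 1 (n + 1) := by simp [h1, h2]
  rw [← mul_prod_erase _ _ hs]
  congr 1
  symm
  refine prod_bij (fun i _ => skip s i) ?_ ?_ ?_ ?_
  · intro i hi
    have := skip_ne s i
    simp only [mem_Icc, mem_erase] at *
    refine ⟨this, ?_⟩
    unfold skip
    split_ifs <;> omega
  · intro a _ b _ h
    exact (skip_strictMono s).injective h
  · intro b hb
    simp only [mem_Icc, mem_erase] at hb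
    refine ⟨if b < s then b else b - 1, ?_, ?_⟩
    · simp only [mem_Icc]
      split_ifs <;> omega
    · unfold skip
      split_ifs <;> omega
  · intros
    rfl

/-- The product of `F p q` over all pairs `1 ≤ p < q ≤ n`. -/
def pairProd {M : Type*} [CommMonoid M] (n : ℕ) (F : ℕ → ℕ → M) : M :=
  ∏ p ∈ Icc 1 n, ∏ q ∈ Icc 1 n, if p < q then F p q else 1

theorem pairProd_mul {M : Type*} [CommMonoid M] (n : ℕ) (F G : ℕ → ℕ → M) :
    pairProd n (fun p q => F p q * G p q) = pairProd n F * pairProd n G := by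
  unfold pairProd
  simp only [← prod_mul_distrib]
  refine prod_congr rfl fun p _ => prod_congr rfl fun q _ => ?_
  split_ifs <;> simp

theorem map_pairProd {M N : Type*} [CommMonoid M] [CommMonoid N] (g : M →* N) (n : ℕ)
    (F : ℕ → ℕ → M) : g (pairProd n F) = pairProd n (fun p q => g (F p q)) := by
  unfold pairProd
  simp only [map_prod, apply_ite g, map_one]

theorem pairProd_skip {M : Type*} [CommMonoid M] (n s : ℕ) (h1 : 1 ≤ s) (h2 : s ≤ n + 1)
    (F : ℕ → ℕ → M) :
    pairProd (n + 1) F = (∏ q ∈ Icc 1 n, if s < skip s q then F s (skip s q) else 1) *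
      (∏ p ∈ Icc 1 n, if skip s p < s then F (skip s p) s else 1) *
      pairProd n (fun p q => F (skip s p) (skip s q)) := by
  unfold pairProd
  rw [prod_Icc_skip n s h1 h2]
  simp only [prod_Icc_skip n s h1 h2, lt_irrefl, if_false, one_mul, prod_mul_distrib, mul_assoc,
    (skip_strictMono s).lt_iff_lt]

theorem prod_Icc_eq_prod_fin {M : Type*} [CommMonoid M] (n : ℕ) (f : ℕ → M) :
    ∏ i ∈ Icc 1 n, f i = ∏ i : Fin n, f (i + 1) := by
  rw [Fin.prod_univ_eq_prod_range (fun i => f (i + 1)) n, range_eq_Ico, prod_Ico_add' f 0 n 1]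
  rfl

theorem pairProd_sub_eq_det {R : Type*} [CommRing R] (n : ℕ) (x : ℕ → R) :
    pairProd n (fun p q => x p - x q) =
      (Matrix.vandermonde (fun i : Fin n => -x (i + 1))).det := by
  rw [Matrix.det_vandermonde]
  unfold pairProd
  rw [prod_Icc_eq_prod_fin]
  refine prod_congr rfl fun i _ => ?_
  rw [prod_Icc_eq_prod_fin]
  have : Ioi i = univ.filter (fun j => i < j) := by
    ext; simp
  rw [this, prod_filter]
  refine prod_congr rfl fun j _ => ?_
  have : (i : ℕ) + 1 < j + 1 ↔ i < j := by rw [Fin.lt_def]; omega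
  simp only [this]
  split_ifs
  · ring
  · rfl

/-- Expansion of the Vandermonde product along its highest powers. -/
theorem pairProd_sub_succ {R : Type*} [CommRing R] (n : ℕ) (x : ℕ → R) :
    pairProd (n + 1) (fun p q => x p - x q) =
      ∑ j ∈ range (n + 1), (-1) ^ j * x (j + 1) ^ n *
        pairProd n (fun p q => x (skip (j + 1) p) - x (skip (j + 1) q)) := by
  rw [pairProd_sub_eq_det, Matrix.det_succ_column _ (Fin.last n),
    ← Fin.sum_univ_eq_sum_range (fun j => (-1) ^ j * x (j + 1) ^ n *
        pairProd n (fun p q => x (skip (j + 1) p) - x (skip (j + 1) q)))]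
  refine sum_congr rfl fun i _ => ?_
  rw [pairProd_sub_eq_det n (fun p => x (skip (i + 1) p))]
  have : (Matrix.vandermonde fun i : Fin (n + 1) => -x (i + 1)).submatrix i.succAbove
      (Fin.last n).succAbove
      = Matrix.vandermonde (fun j : Fin n => -x (skip (i + 1) (j + 1))) := by
    ext a b
    simp only [Matrix.submatrix_apply, Matrix.vandermonde_apply, Fin.succAbove_last,
      Fin.val_castSucc]
    congr 3
    simp only [Fin.succAbove, skip, Fin.lt_def, Fin.val_castSucc]
    split_ifs <;> simp <;> omega
  rw [this]
  simp only [Matrix.vandermonde_apply, Fin.val_last]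
  rw [neg_pow (x _), pow_add]
  have h : ((-1 : R) ^ n) * (-1) ^ n = 1 := by
    rw [← mul_pow]; simp
  linear_combination ((-1) ^ (i : ℕ) * x (i + 1) ^ n *
    (Matrix.vandermonde (fun j : Fin n => -x (skip (i + 1) (j + 1)))).det) * h

theorem gogDeg_apply (n k i : ℕ) : gogDeg n k i =
    if 1 ≤ i ∧ i ≤ k then n - 1 else if k + 1 ≤ i ∧ i ≤ n then n + k - i else 0 := by
  unfold gogDeg
  simp only [Finsupp.add_apply, Finsupp.finsetSum_apply, Finsupp.single_apply, sum_ite_eq',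
    mem_Icc]
  split_ifs <;> omega

/-- The exponent vector of the `n`-variable constant term after all of the first `k` variables
have gained one more power. -/
noncomputable def gogDegSucc (n k : ℕ) : ℕ →₀ ℕ :=
  gogDeg n k + ∑ i ∈ Icc 1 k, Finsupp.single i 1

theorem gogDegSucc_apply (n k i : ℕ) (hkn : k ≤ n) : gogDegSucc n k i =
    if 1 ≤ i ∧ i ≤ k then n else if k + 1 ≤ i ∧ i ≤ n then n + k - i else 0 := by
  unfold gogDegSucc
  simp only [Finsupp.add_apply, Finsupp.finsetSum_apply, Finsupp.single_apply, sum_ite_eq',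
    mem_Icc, gogDeg_apply]
  split_ifs <;> omega

theorem gogDeg_succ_eq (n k j : ℕ) (hkn : k ≤ n) (hj : j ≤ k) :
    gogDeg (n + 1) k =
      (gogDegSucc n k).mapDomain (skip (j + 1)) + Finsupp.single (j + 1) n := by
  ext t
  rw [Finsupp.add_apply, gogDeg_apply]
  by_cases ht : t = j + 1
  · subst ht
    rw [Finsupp.mapDomain_of_notMem_range _ _ (by rintro ⟨i, hi⟩; exact skip_ne _ _ hi)]
    rw [Finsupp.single_eq_same]
    split_ifs <;> omega
  · obtain ⟨u, rfl⟩ : ∃ u, skip (j + 1) u = t :=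
      ⟨if t < j + 1 then t else t - 1, by unfold skip; split_ifs <;> omega⟩
    rw [Finsupp.mapDomain_apply (skip_strictMono _).injective, gogDegSucc_apply _ _ _ hkn,
      Finsupp.single_eq_of_ne ht]
    unfold skip
    split_ifs <;> omega

theorem gogDeg_succ_self (n : ℕ) : gogDeg (n + 1) (n + 1) = gogDeg (n + 1) n := by
  ext t
  rw [gogDeg_apply, gogDeg_apply]
  split_ifs <;> omega

/-- Set `x_s = 0` and renumber the remaining variables consecutively. -/
noncomputable def dropVar (s : ℕ) : MvPolynomial ℕ ℚ →ₐ[ℚ] MvPolynomial ℕ ℚ :=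
  aeval fun i => if i < s then X i else if i = s then 0 else X (i - 1)

theorem dropVar_X_self (s : ℕ) : dropVar s (X s) = 0 := by
  simp [dropVar]

theorem dropVar_X_skip (s i : ℕ) : dropVar s (X (skip s i)) = X i := by
  have := skip_ne s i
  unfold dropVar skip at *
  rw [aeval_X]
  split_ifs at * <;> first | rfl | omega

theorem X_dvd_sub_rename_dropVar (s : ℕ) (Q : MvPolynomial ℕ ℚ) :
    X s ∣ Q - rename (skip s) (dropVar s Q) := by
  induction Q using MvPolynomial.induction_on with
  | C a => simp
  | add p q hp hq =>
    rw [map_add, map_add, add_sub_add_comm]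
    exact dvd_add hp hq
  | mul_X p i hp =>
    rw [map_mul, map_mul]
    by_cases hi : i = s
    · subst hi
      simp [dropVar_X_self]
    · obtain ⟨u, rfl⟩ : ∃ u, skip s u = i :=
        ⟨if i < s then i else i - 1, by unfold skip; split_ifs <;> omega⟩
      rw [dropVar_X_skip, rename_X, ← sub_mul]
      exact Dvd.dvd.mul_right hp _

theorem coeff_dropVar (s : ℕ) (d : ℕ →₀ ℕ) (Q : MvPolynomial ℕ ℚ) :
    coeff d (dropVar s Q) = coeff (d.mapDomain (skip s)) Q := by
  obtain ⟨P, hP⟩ := X_dvd_sub_rename_dropVar s Q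
  have h0 : d.mapDomain (skip s) s = 0 :=
    Finsupp.mapDomain_of_notMem_range _ _ (by rintro ⟨i, hi⟩; exact skip_ne _ _ hi)
  have hQ : coeff (d.mapDomain (skip s)) Q =
      coeff (d.mapDomain (skip s)) (X s * P + rename (skip s) (dropVar s Q)) := by
    rw [← hP, sub_add_cancel]
  rw [hQ, coeff_add, coeff_X_mul', if_neg (by simpa using h0), zero_add,
    coeff_rename_mapDomain _ (skip_strictMono s).injective]

theorem coeff_X_pow_mul_eq_dropVar (s N : ℕ) (d : ℕ →₀ ℕ) (Q : MvPolynomial ℕ ℚ) :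
    coeff (d.mapDomain (skip s) + Finsupp.single s N) (X s ^ N * Q) = coeff d (dropVar s Q) := by
  rw [coeff_dropVar, mul_comm, X_pow_eq_monomial, coeff_mul_monomial, mul_one]

/-- The factor `(x_p − x_q)(1 + x_q + x_p x_q)` of the constant term formula. -/
noncomputable def gogFactor (p q : ℕ) : MvPolynomial ℕ ℚ :=
  (X p - X q) * (1 + X q + X p * X q)

/-- The polynomial `∏ (1 + x_i)^{c_i} ∏_{i<j} (x_i − x_j)(1 + x_j + x_i x_j)`. -/
noncomputable def gogPoly (n : ℕ) (c : ℕ → ℕ) : MvPolynomial ℕ ℚ :=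
  (∏ i ∈ Icc 1 n, (1 + X i) ^ c i) * pairProd n gogFactor

theorem dropVar_gogPoly_aux (n j : ℕ) (hj : j ≤ n) (c : ℕ → ℕ) :
    dropVar (j + 1) ((∏ i ∈ Icc 1 (n + 1), (1 + X i) ^ c i) *
      pairProd (n + 1) (fun p q => 1 + X q + X p * X q) *
      pairProd n (fun p q => X (skip (j + 1) p) - X (skip (j + 1) q))) =
    gogPoly n (fun i => if i ≤ j then c i else c (i + 1) + 1) := by
  have e1 : dropVar (j + 1) (∏ i ∈ Icc 1 (n + 1), (1 + X i) ^ c i) =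
      ∏ i ∈ Icc 1 n, (1 + X i) ^ c (skip (j + 1) i) := by
    rw [prod_Icc_skip n (j + 1) (by omega) (by omega)]
    simp only [map_mul, map_prod, map_pow, map_add, map_one, dropVar_X_self, dropVar_X_skip]
    simp
  have e2 : dropVar (j + 1) (pairProd (n + 1) (fun p q => 1 + X q + X p * X q)) =
      (∏ i ∈ Icc 1 n, if i ≤ j then 1 else 1 + X i) *
      pairProd n (fun p q => 1 + X q + X p * X q) := by
    rw [pairProd_skip n (j + 1) (by omega) (by omega)]
    have h := map_pairProd (dropVar (j + 1) : MvPolynomial ℕ ℚ →* MvPolynomial ℕ ℚ) n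
      (fun p q => 1 + X (skip (j + 1) q) + X (skip (j + 1) p) * X (skip (j + 1) q))
    simp only [MonoidHom.coe_coe] at h
    simp only [map_mul, map_prod, h, apply_ite (dropVar (j + 1)), map_add, map_one,
      dropVar_X_self, dropVar_X_skip]
    simp only [zero_mul, mul_zero, add_zero, ite_self, prod_const_one, mul_one]
    congr 1
    refine prod_congr rfl fun i _ => ?_
    unfold skip
    split_ifs <;> first | rfl | omega
  have e3 : dropVar (j + 1) (pairProd n
      (fun p q => X (skip (j + 1) p) - X (skip (j + 1) q))) =
      pairProd n (fun p q => X p - X q) := by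
    have h := map_pairProd (dropVar (j + 1) : MvPolynomial ℕ ℚ →* MvPolynomial ℕ ℚ) n
      (fun p q => X (skip (j + 1) p) - X (skip (j + 1) q))
    simp only [MonoidHom.coe_coe] at h
    simp only [h, map_sub, dropVar_X_skip]
  rw [map_mul, map_mul, e1, e2, e3]
  unfold gogPoly gogFactor
  rw [pairProd_mul]
  have e4 : (∏ i ∈ Icc 1 n, (1 + X i : MvPolynomial ℕ ℚ) ^
      (if i ≤ j then c i else c (i + 1) + 1)) =
      (∏ i ∈ Icc 1 n, (1 + X i) ^ c (skip (j + 1) i)) *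
        ∏ i ∈ Icc 1 n, if i ≤ j then 1 else 1 + X i := by
    rw [← prod_mul_distrib]
    refine prod_congr rfl fun i _ => ?_
    unfold skip
    split_ifs
    · simp
    · omega
    · omega
    · rw [pow_succ]
  rw [e4]
  ring

theorem coeff_gogPoly_succ (n k : ℕ) (hkn : k ≤ n) (c : ℕ → ℕ) :
    coeff (gogDeg (n + 1) k) (gogPoly (n + 1) c) =
      ∑ j ∈ range (k + 1), (-1) ^ j *
        coeff (gogDegSucc n k) (gogPoly n (fun i => if i ≤ j then c i else c (i + 1) + 1)) := by
  have key : gogPoly (n + 1) c = ∑ j ∈ range (n + 1), C ((-1) ^ j) *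
      (X (j + 1) ^ n * ((∏ i ∈ Icc 1 (n + 1), (1 + X i) ^ c i) *
        pairProd (n + 1) (fun p q => 1 + X q + X p * X q) *
        pairProd n (fun p q => X (skip (j + 1) p) - X (skip (j + 1) q)))) := by
    unfold gogPoly gogFactor
    rw [pairProd_mul, pairProd_sub_succ, sum_mul, mul_sum]
    refine sum_congr rfl fun j _ => ?_
    simp only [map_pow, map_neg, map_one]
    ring
  rw [key, coeff_sum]
  simp only [coeff_C_mul]
  symm
  refine sum_subset_zero_on_sdiff (by simpa using hkn) ?_ ?_
  · intro j hj
    simp only [mem_sdiff, mem_range] at hj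
    rw [X_pow_eq_monomial, coeff_monomial_mul', if_neg, mul_zero]
    intro h
    have h2 := h (j + 1)
    rw [Finsupp.single_eq_same, gogDeg_apply] at h2
    split_ifs at h2 <;> omega
  · intro j hj
    simp only [mem_range] at hj
    rw [gogDeg_succ_eq n k j hkn (by omega), coeff_X_pow_mul_eq_dropVar,
      dropVar_gogPoly_aux n j (by omega)]

theorem prod_Icc_split {M : Type*} [CommMonoid M] (n k : ℕ) (hkn : k ≤ n) (f : ℕ → M) :
    ∏ i ∈ Icc 1 n, f i = (∏ i ∈ Icc 1 k, f i) * ∏ i ∈ Icc (k + 1) n, f i := by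
  have hu : Icc 1 n = Icc 1 k ∪ Icc (k + 1) n := by
    ext i
    simp only [mem_union, mem_Icc]
    omega
  rw [hu, prod_union]
  rw [disjoint_left]
  intro i
  simp only [mem_Icc]
  omega

theorem pairProd_eq_prod_filter {M : Type*} [CommMonoid M] (n : ℕ) (F : ℕ → ℕ → M) :
    pairProd n F = ∏ p ∈ (Icc 1 n ×ˢ Icc 1 n).filter (fun p => p.1 < p.2), F p.1 p.2 := by
  unfold pairProd
  rw [prod_filter, prod_product]

theorem rename_swap_gogFactor_prod (n p : ℕ) (hp : 1 ≤ p) (hpn : p + 1 ≤ n) :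
    rename (Equiv.swap p (p + 1)) ((1 + X p + X p * X (p + 1)) * pairProd n gogFactor) =
      -((1 + X p + X p * X (p + 1)) * pairProd n gogFactor) := by
  set s := (Icc 1 n ×ˢ Icc 1 n).filter (fun p : ℕ × ℕ => p.1 < p.2) with hs
  have hmem : (p, p + 1) ∈ s := by
    simp only [hs, mem_filter, mem_product, mem_Icc]
    omega
  rw [pairProd_eq_prod_filter, ← hs, ← mul_prod_erase s _ hmem]
  have hrest : rename (Equiv.swap p (p + 1)) (∏ x ∈ s.erase (p, p + 1), gogFactor x.1 x.2) =
      ∏ x ∈ s.erase (p, p + 1), gogFactor x.1 x.2 := by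
    rw [map_prod]
    have hmaps : ∀ x ∈ s.erase (p, p + 1),
        (Equiv.swap p (p + 1) x.1, Equiv.swap p (p + 1) x.2) ∈ s.erase (p, p + 1) := by
      rintro ⟨x, y⟩ hx
      simp only [hs, mem_erase, mem_filter, mem_product, mem_Icc, ne_eq, Prod.mk.injEq,
        Equiv.swap_apply_def] at hx ⊢
      split_ifs <;> omega
    refine prod_nbij' (fun x => (Equiv.swap p (p + 1) x.1, Equiv.swap p (p + 1) x.2))
      (fun x => (Equiv.swap p (p + 1) x.1, Equiv.swap p (p + 1) x.2)) hmaps hmaps ?_ ?_ ?_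
    · intro x _
      simp
    · intro x _
      simp
    · intro x _
      simp [gogFactor]
  rw [map_mul, map_mul, hrest]
  simp only [gogFactor, map_mul, map_add, map_sub, map_one, rename_X, Equiv.swap_apply_left,
    Equiv.swap_apply_right]
  ring

/-- The span of the polynomials `(1 + x_p + x_p x_{p+1}) f` with `p < k` and `f` symmetric in
`x_p` and `x_{p+1}`. -/
noncomputable def swapKernel (k : ℕ) : Submodule ℚ (MvPolynomial ℕ ℚ) :=
  Submodule.span ℚ {g | ∃ p f, 1 ≤ p ∧ p + 1 ≤ k ∧ rename (Equiv.swap p (p + 1)) f = f ∧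
    g = (1 + X p + X p * X (p + 1)) * f}

theorem mul_mem_swapKernel {k k' : ℕ} (hk : k ≤ k') {g h : MvPolynomial ℕ ℚ}
    (hg : g ∈ swapKernel k)
    (hh : ∀ p, 1 ≤ p → p + 1 ≤ k → rename (Equiv.swap p (p + 1)) h = h) :
    g * h ∈ swapKernel k' := by
  induction hg using Submodule.span_induction with
  | mem x hx =>
    obtain ⟨p, f, h1, h2, h3, rfl⟩ := hx
    refine Submodule.subset_span ⟨p, f * h, h1, h2.trans hk, ?_, by ring⟩
    rw [map_mul, h3, hh p h1 h2]
  | zero => simp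
  | add x y _ _ hx hy =>
    rw [add_mul]
    exact Submodule.add_mem _ hx hy
  | smul a x _ hx =>
    rw [smul_mul_assoc]
    exact Submodule.smul_mem _ _ hx

theorem coeff_mul_eq_zero_of_mem_swapKernel (n k : ℕ) (hkn : k ≤ n) {g : MvPolynomial ℕ ℚ}
    (hg : g ∈ swapKernel k) (t : ℕ → ℕ) :
    coeff (gogDegSucc n k) (g * ((∏ i ∈ Icc (k + 1) n, (1 + X i) ^ t i) *
      pairProd n gogFactor)) = 0 := by
  induction hg using Submodule.span_induction with
  | mem x hx =>
    obtain ⟨p, f, h1, h2, h3, rfl⟩ := hx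
    set σ := Equiv.swap p (p + 1) with hσ
    have ht : rename σ (∏ i ∈ Icc (k + 1) n, (1 + X i : MvPolynomial ℕ ℚ) ^ t i) =
        ∏ i ∈ Icc (k + 1) n, (1 + X i) ^ t i := by
      rw [map_prod]
      refine prod_congr rfl fun i hi => ?_
      rw [mem_Icc] at hi
      rw [map_pow, map_add, map_one, rename_X,
        Equiv.swap_apply_of_ne_of_ne (by omega) (by omega)]
    have hd : (gogDegSucc n k).mapDomain σ = gogDegSucc n k := by
      ext i
      rw [← Equiv.apply_symm_apply σ i, Finsupp.mapDomain_apply σ.injective,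
        Equiv.apply_symm_apply, hσ, Equiv.symm_swap, gogDegSucc_apply _ _ _ hkn,
        gogDegSucc_apply _ _ _ hkn, Equiv.swap_apply_def]
      split_ifs <;> omega
    have hneg : ∀ φ : MvPolynomial ℕ ℚ, rename σ φ = -φ → coeff (gogDegSucc n k) φ = 0 := by
      intro φ hφ
      have := coeff_rename_mapDomain σ σ.injective φ (gogDegSucc n k)
      rw [hd, hφ, coeff_neg] at this
      linarith
    apply hneg
    have hV := rename_swap_gogFactor_prod n p h1 (by omega)
    rw [← hσ, map_mul] at hV
    rw [map_mul, map_mul, map_mul, h3, ht]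
    linear_combination (f * ∏ i ∈ Icc (k + 1) n, (1 + X i) ^ t i) * hV
  | zero => simp
  | add x y _ _ hx hy => rw [add_mul, coeff_add, hx, hy, add_zero]
  | smul a x _ hx => rw [smul_mul_assoc, coeff_smul, hx, smul_zero]

/-- The generating polynomial of the strictly increasing sequences interlacing
`c 1 < ⋯ < c (k+1)`, see `sum_interlacing`. -/
noncomputable def interlacePoly (c : ℕ → ℕ) : ℕ → MvPolynomial ℕ ℚ
  | 0 => 1
  | 1 => (1 + X 1) ^ (c 2 + 1) - (1 + X 1) ^ c 1
  | k + 2 => interlacePoly c (k + 1) *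
      ((1 + X (k + 2)) ^ (c (k + 3) + 1) - (1 + X (k + 2)) ^ c (k + 2)) -
      interlacePoly c k * ((X (k + 1) * (1 + X (k + 1)) ^ c (k + 2)) *
        (X (k + 2) * (1 + X (k + 2)) ^ c (k + 2)))

/-- The alternating sum of the monomial products obtained by deleting one of
`c 1, …, c (k+1)`. -/
noncomputable def deletionPoly (c : ℕ → ℕ) (k : ℕ) : MvPolynomial ℕ ℚ :=
  ∑ j ∈ range (k + 1), (-1) ^ j *
    ∏ i ∈ Icc 1 k, (1 + X i) ^ (if i ≤ j then c i else c (i + 1) + 1)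

theorem deletionPoly_succ (c : ℕ → ℕ) (k : ℕ) : deletionPoly c (k + 1) =
    deletionPoly c k * (1 + X (k + 1)) ^ (c (k + 2) + 1) +
      (-1) ^ (k + 1) * ((∏ i ∈ Icc 1 k, (1 + X i) ^ c i) * (1 + X (k + 1)) ^ c (k + 1)) := by
  unfold deletionPoly
  rw [sum_range_succ, sum_mul]
  refine congrArg₂ (· + ·) ?_ ?_
  · refine sum_congr rfl fun j hj => ?_
    rw [mem_range] at hj
    rw [prod_Icc_succ_top (by omega), if_neg (by omega), mul_assoc]
  · rw [prod_Icc_succ_top (by omega), if_pos le_rfl]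
    refine congrArg (fun x => (-1) ^ (k + 1) * (x * (1 + X (k + 1)) ^ c (k + 1))) ?_
    refine prod_congr rfl fun i hi => ?_
    rw [mem_Icc] at hi
    rw [if_pos (by omega)]

theorem rename_deletionPoly (c : ℕ → ℕ) (k p : ℕ) (hp : k < p) :
    rename (Equiv.swap p (p + 1)) (deletionPoly c k) = deletionPoly c k := by
  unfold deletionPoly
  simp only [map_sum, map_mul, map_pow, map_neg, map_one, map_prod, map_add, rename_X]
  refine sum_congr rfl fun j _ => ?_
  congr 1
  refine prod_congr rfl fun i hi => ?_
  rw [mem_Icc] at hi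
  rw [Equiv.swap_apply_of_ne_of_ne (by omega) (by omega)]

theorem interlacePoly_sub_deletionPoly_mem (c : ℕ → ℕ) (k : ℕ) :
    interlacePoly c k - deletionPoly c k ∈ swapKernel k := by
  induction k using Nat.twoStepInduction with
  | zero => simp [interlacePoly, deletionPoly]
  | one =>
    have h : interlacePoly c 1 - deletionPoly c 1 = 0 := by
      rw [deletionPoly_succ]
      simp only [interlacePoly, deletionPoly, zero_add, range_one, sum_singleton, pow_zero,
        one_mul, Icc_eq_empty_of_lt zero_lt_one, prod_empty]
      ring
    rw [h]
    exact Submodule.zero_mem _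
  | more k ih0 ih1 =>
    have hX : ∀ p i : ℕ, i ≠ p → i ≠ p + 1 →
        rename (Equiv.swap p (p + 1)) (X i : MvPolynomial ℕ ℚ) = X i := by
      intro p i h1 h2
      rw [rename_X, Equiv.swap_apply_of_ne_of_ne h1 h2]
    have h1 := mul_mem_swapKernel (Nat.le_succ (k + 1)) ih1
      (h := (1 + X (k + 2)) ^ (c (k + 3) + 1) - (1 + X (k + 2)) ^ c (k + 2)) (by
        intro p hp hpk
        simp only [map_sub, map_pow, map_add, map_one,
          hX p (k + 2) (by omega) (by omega)])
    have h2 := mul_mem_swapKernel (k.le_add_right 2) ih0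
      (h := (X (k + 1) * (1 + X (k + 1)) ^ c (k + 2)) *
        (X (k + 2) * (1 + X (k + 2)) ^ c (k + 2))) (by
        intro p hp hpk
        simp only [map_mul, map_pow, map_add, map_one, hX p (k + 2) (by omega) (by omega),
          hX p (k + 1) (by omega) (by omega)])
    have h3 : (1 + X (k + 1) + X (k + 1) * X (k + 2)) * (deletionPoly c k *
        ((1 + X (k + 1)) ^ c (k + 2) * (1 + X (k + 2)) ^ c (k + 2))) ∈ swapKernel (k + 2) := by
      refine Submodule.subset_span ⟨k + 1, _, by omega, by omega, ?_, rfl⟩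
      simp only [map_mul, map_pow, map_add, map_one, rename_X, Equiv.swap_apply_left,
        Equiv.swap_apply_right, rename_deletionPoly c k (k + 1) (by omega)]
      ring
    convert Submodule.sub_mem _ (Submodule.sub_mem _ h1 h2) h3 using 1
    rw [interlacePoly, deletionPoly_succ c (k + 1), deletionPoly_succ c k,
      prod_Icc_succ_top (by omega)]
    ring

theorem coeff_interlacePoly_mul (n k : ℕ) (hkn : k ≤ n) (c : ℕ → ℕ) :
    coeff (gogDegSucc n k) (interlacePoly c k *
      ((∏ i ∈ Icc (k + 1) n, (1 + X i) ^ (c (i + 1) + 1)) * pairProd n gogFactor)) =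
    coeff (gogDeg (n + 1) k) (gogPoly (n + 1) c) := by
  have h := coeff_mul_eq_zero_of_mem_swapKernel n k hkn
    (interlacePoly_sub_deletionPoly_mem c k) (fun i => c (i + 1) + 1)
  rw [sub_mul, coeff_sub, sub_eq_zero] at h
  rw [h, coeff_gogPoly_succ n k hkn, deletionPoly, sum_mul, coeff_sum]
  refine sum_congr rfl fun j hj => ?_
  rw [mem_range] at hj
  have hC : ((-1) ^ j : MvPolynomial ℕ ℚ) = C ((-1) ^ j) := by simp
  rw [hC, mul_assoc, coeff_C_mul, gogPoly, ← mul_assoc]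
  congr 3
  rw [prod_Icc_split n k hkn]
  congr 1
  refine prod_congr rfl fun i hi => ?_
  rw [mem_Icc] at hi
  rw [if_neg (by omega)]

open Classical in
/-- The sequences `l 1 < ⋯ < l k` with `c i ≤ l i ≤ c (i+1)`, extended by zero. -/
noncomputable def interlacing (c : ℕ → ℕ) : ℕ → Finset (ℕ → ℕ)
  | 0 => {0}
  | k + 1 => ((interlacing c k ×ˢ Icc (c (k + 1)) (c (k + 2))).filter
      (fun x => x.1 k < x.2)).image (fun x => Function.update x.1 (k + 1) x.2)

theorem mem_interlacing (c : ℕ → ℕ) (k : ℕ) (l : ℕ → ℕ) : l ∈ interlacing c k ↔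
    (∀ i, 1 ≤ i → i ≤ k → c i ≤ l i ∧ l i ≤ c (i + 1)) ∧
    (∀ i, i < k → l i < l (i + 1)) ∧ ∀ i, ¬ (1 ≤ i ∧ i ≤ k) → l i = 0 := by
  induction k generalizing l with
  | zero =>
    simp only [interlacing, mem_singleton]
    constructor
    · rintro rfl
      exact ⟨by omega, by omega, by simp⟩
    · rintro ⟨-, -, h⟩
      funext i
      exact h i (by omega)
  | succ k ih =>
    simp only [interlacing, mem_image, mem_filter, mem_product, mem_Icc, Prod.exists, ih]
    constructor
    · rintro ⟨l', x, ⟨⟨⟨h1, h2, h3⟩, hx⟩, hlt⟩, rfl⟩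
      refine ⟨?_, ?_, ?_⟩
      · intro i hi hik
        by_cases h : i = k + 1
        · subst h
          simpa using hx
        · rw [Function.update_of_ne h]
          exact h1 i hi (by omega)
      · intro i hik
        rw [Function.update_of_ne (by omega)]
        by_cases h : i = k
        · subst h
          simpa using hlt
        · rw [Function.update_of_ne (by omega)]
          exact h2 i (by omega)
      · intro i hi
        rw [Function.update_of_ne (by omega)]
        exact h3 i (by omega)
    · rintro ⟨h1, h2, h3⟩
      refine ⟨Function.update l (k + 1) 0, l (k + 1), ⟨⟨⟨?_, ?_, ?_⟩, ?_⟩, ?_⟩, by simp⟩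
      · intro i hi hik
        rw [Function.update_of_ne (by omega)]
        exact h1 i hi (by omega)
      · intro i hik
        rw [Function.update_of_ne (by omega), Function.update_of_ne (by omega)]
        exact h2 i (by omega)
      · intro i hi
        by_cases h : i = k + 1
        · subst h
          simp
        · rw [Function.update_of_ne h]
          exact h3 i (by omega)
      · exact h1 (k + 1) (by omega) le_rfl
      · rw [Function.update_of_ne (by omega)]
        exact h2 k (by omega)

theorem sum_interlacing_succ {R : Type*} [CommRing R] (c : ℕ → ℕ) (k : ℕ) (f : ℕ → ℕ → R) :
    ∑ l ∈ interlacing c (k + 1), ∏ i ∈ Icc 1 (k + 1), f i (l i) =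
      ∑ x ∈ (interlacing c k ×ˢ Icc (c (k + 1)) (c (k + 2))).filter (fun x => x.1 k < x.2),
        (∏ i ∈ Icc 1 k, f i (x.1 i)) * f (k + 1) x.2 := by
  classical
  rw [interlacing, sum_image]
  · refine sum_congr rfl fun x _ => ?_
    rw [prod_Icc_succ_top (by omega), Function.update_self]
    congr 1
    refine prod_congr rfl fun i hi => ?_
    rw [mem_Icc] at hi
    rw [Function.update_of_ne (by omega)]
  · intro x hx y hy hxy
    simp only [coe_filter, Set.mem_ofPred_eq, mem_product, mem_interlacing] at hx hy
    have hval : ∀ i, Function.update x.1 (k + 1) x.2 i = Function.update y.1 (k + 1) y.2 i :=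
      fun i => congrFun hxy i
    refine Prod.ext (funext fun i => ?_) (by simpa using hval (k + 1))
    by_cases h : i = k + 1
    · rw [hx.1.1.2.2 i (by omega), hy.1.1.2.2 i (by omega)]
    · simpa [Function.update_of_ne h] using hval i

theorem sum_interlacing_succ_succ {R : Type*} [CommRing R] (c : ℕ → ℕ) (k : ℕ)
    (hc : ∀ i, i ≤ k + 2 → c i < c (i + 1)) (f : ℕ → ℕ → R) :
    ∑ l ∈ interlacing c (k + 2), ∏ i ∈ Icc 1 (k + 2), f i (l i) =
      (∑ l ∈ interlacing c (k + 1), ∏ i ∈ Icc 1 (k + 1), f i (l i)) *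
        (∑ x ∈ Icc (c (k + 2)) (c (k + 3)), f (k + 2) x) -
      (∑ l ∈ interlacing c k, ∏ i ∈ Icc 1 k, f i (l i)) *
        (f (k + 1) (c (k + 2)) * f (k + 2) (c (k + 2))) := by
  rw [sum_interlacing_succ c (k + 1) f, eq_sub_iff_add_eq, sum_mul_sum, ← sum_product',
    ← sum_filter_add_sum_filter_not (interlacing c (k + 1) ×ˢ Icc (c (k + 2)) (c (k + 3)))
      (fun x => x.1 (k + 1) < x.2)]
  congr 1
  rw [sum_mul]
  have hc1 : c (k + 1) < c (k + 2) := hc (k + 1) (by omega)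
  refine sum_bij' (fun l _ => (Function.update l (k + 1) (c (k + 2)), c (k + 2)))
    (fun x _ => Function.update x.1 (k + 1) 0) ?_ ?_ ?_ ?_ ?_
  · intro l hl
    rw [mem_interlacing] at hl
    obtain ⟨h1, h2, h3⟩ := hl
    simp only [mem_filter, mem_product, mem_interlacing, mem_Icc, Function.update_self,
      lt_irrefl, not_false_eq_true, and_true, le_refl, true_and]
    refine ⟨⟨?_, ?_, ?_⟩, (hc (k + 2) le_rfl).le⟩
    · intro i hi hik
      by_cases h : i = k + 1
      · subst h
        rw [Function.update_self]
        exact ⟨hc1.le, le_rfl⟩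
      · rw [Function.update_of_ne h]
        exact h1 i hi (by omega)
    · intro i hik
      rw [Function.update_of_ne (by omega)]
      by_cases h : i = k
      · subst h
        rw [Function.update_self]
        by_cases hi : i = 0
        · rw [h3 i (by omega)]
          omega
        · exact (h1 i (by omega) le_rfl).2.trans_lt hc1
      · rw [Function.update_of_ne (by omega)]
        exact h2 i (by omega)
    · intro i hi
      rw [Function.update_of_ne (by omega)]
      exact h3 i (by omega)
  · intro x hx
    simp only [mem_filter, mem_product, mem_interlacing, mem_Icc] at hx
    obtain ⟨⟨⟨h1, h2, h3⟩, -⟩, -⟩ := hx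
    rw [mem_interlacing]
    refine ⟨?_, ?_, ?_⟩
    · intro i hi hik
      rw [Function.update_of_ne (by omega)]
      exact h1 i hi (by omega)
    · intro i hik
      rw [Function.update_of_ne (by omega), Function.update_of_ne (by omega)]
      exact h2 i (by omega)
    · intro i hi
      by_cases h : i = k + 1
      · subst h
        simp
      · rw [Function.update_of_ne h]
        exact h3 i (by omega)
  · intro l hl
    rw [mem_interlacing] at hl
    have := hl.2.2 (k + 1) (by omega)
    simp [← this]
  · intro x hx
    simp only [mem_filter, mem_product, mem_interlacing, mem_Icc] at hx
    obtain ⟨⟨⟨h1, h2, h3⟩, h4⟩, h5⟩ := hx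
    have h6 : x.1 (k + 1) ≤ c (k + 2) := (h1 (k + 1) (by omega) le_rfl).2
    have h7 : c (k + 2) = x.2 := by omega
    have h8 : c (k + 2) = x.1 (k + 1) := by omega
    refine Prod.ext ?_ h7
    rw [Function.update_idem, h8, Function.update_eq_self]
  · intro l hl
    dsimp only
    rw [prod_Icc_succ_top (by omega), Function.update_self, mul_assoc]
    congr 1
    refine prod_congr rfl fun i hi => ?_
    rw [mem_Icc] at hi
    rw [Function.update_of_ne (by omega)]

theorem sum_Icc_mul_one_add_pow {R : Type*} [CommRing R] (x : R) (a b : ℕ) (hab : a ≤ b) :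
    ∑ i ∈ Icc a b, x * (1 + x) ^ i = (1 + x) ^ (b + 1) - (1 + x) ^ a := by
  induction b, hab using Nat.le_induction with
  | base =>
    simp only [Icc_self, sum_singleton]
    ring
  | succ b hb ih =>
    rw [sum_Icc_succ_top (by omega), ih]
    ring

theorem sum_interlacing (c : ℕ → ℕ) (k : ℕ)
    (hc : ∀ i, i ≤ k → c i < c (i + 1)) :
    ∑ l ∈ interlacing c k, ∏ i ∈ Icc 1 k, (X i * (1 + X i) ^ l i : MvPolynomial ℕ ℚ) =
      interlacePoly c k := by
  induction k using Nat.twoStepInduction with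
  | zero => simp [interlacing, interlacePoly]
  | one =>
    have h := hc 0 (by omega)
    rw [sum_interlacing_succ c 0 (fun i e => (X i * (1 + X i) ^ e : MvPolynomial ℕ ℚ)),
      interlacePoly, ← sum_Icc_mul_one_add_pow _ _ _ (hc 1 le_rfl).le, filter_true_of_mem]
    · simp [interlacing]
    · rintro ⟨l, x⟩ hx
      simp only [interlacing, mem_product, mem_singleton, mem_Icc] at hx
      simp only [hx.1, Pi.zero_apply]
      omega
  | more k ih0 ih1 =>
    rw [sum_interlacing_succ_succ c k hc
      (fun i e => (X i * (1 + X i) ^ e : MvPolynomial ℕ ℚ)), ih0 fun i hi => hc i (by omega),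
      ih1 fun i hi => hc i (by omega), sum_Icc_mul_one_add_pow _ _ _ (hc (k + 2) le_rfl).le,
      interlacePoly]

/-- The constant term satisfies the row-by-row recursion for Gog trapezoids. -/
theorem sum_coeff_interlacing (n k : ℕ) (hkn : k ≤ n) (c : ℕ → ℕ)
    (hc : ∀ i, i ≤ k → c i < c (i + 1)) :
    ∑ l ∈ interlacing c k, coeff (gogDeg n k)
      (gogPoly n (fun i => if i ≤ k then l i else c (i + 1) + 1)) =
    coeff (gogDeg (n + 1) k) (gogPoly (n + 1) c) := by
  rw [← coeff_interlacePoly_mul n k hkn, ← sum_interlacing c k hc, sum_mul, coeff_sum]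
  refine sum_congr rfl fun l _ => ?_
  have hm : (∏ i ∈ Icc 1 k, X i : MvPolynomial ℕ ℚ) =
      monomial (∑ i ∈ Icc 1 k, Finsupp.single i 1) 1 := by
    rw [monomial_sum_one]
    rfl
  have hs : (∏ i ∈ Icc 1 k, (X i * (1 + X i) ^ l i)) *
      ((∏ i ∈ Icc (k + 1) n, (1 + X i) ^ (c (i + 1) + 1)) * pairProd n gogFactor) =
      gogPoly n (fun i => if i ≤ k then l i else c (i + 1) + 1) *
        monomial (∑ i ∈ Icc 1 k, Finsupp.single i 1) 1 := by
    rw [← hm, prod_mul_distrib, gogPoly, prod_Icc_split n k hkn]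
    have e1 : ∏ i ∈ Icc 1 k, (1 + X i : MvPolynomial ℕ ℚ) ^
        (if i ≤ k then l i else c (i + 1) + 1) = ∏ i ∈ Icc 1 k, (1 + X i) ^ l i := by
      refine prod_congr rfl fun i hi => ?_
      rw [mem_Icc] at hi
      rw [if_pos hi.2]
    have e2 : ∏ i ∈ Icc (k + 1) n, (1 + X i : MvPolynomial ℕ ℚ) ^
        (if i ≤ k then l i else c (i + 1) + 1) =
        ∏ i ∈ Icc (k + 1) n, (1 + X i) ^ (c (i + 1) + 1) := by
      refine prod_congr rfl fun i hi => ?_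
      rw [mem_Icc] at hi
      rw [if_neg (by omega)]
    rw [e1, e2]
    ring
  rw [hs, gogDegSucc, coeff_mul_monomial, mul_one]

/-- Put the row `c 1, …, c (min (N+1) k)` below the first `N` rows of `a`. -/
def appendRow (N k : ℕ) (c : ℕ → ℕ) (a : ℕ → ℕ → ℤ) : ℕ → ℕ → ℤ := fun i j =>
  if i = N + 1 then (if 1 ≤ j ∧ j ≤ min (N + 1) k then (c j : ℤ) else 0) else a i j

/-- The exponents `c 1, …, c r` continued by the constant `b`. -/
def padConst (r b : ℕ) (c : ℕ → ℕ) : ℕ → ℕ := fun i => if i ≤ r then c i else b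

theorem isGog_appendRow {m N k : ℕ} {c l : ℕ → ℕ} {a : ℕ → ℕ → ℤ}
    (hc : ∀ i, i < min (N + 1) k → c i < c (i + 1))
    (hb : ∀ j, j ≤ min (N + 1) k → c j ≤ m + j)
    (hl : l ∈ interlacing (padConst (min (N + 1) k) (m + k + 1) c) (min N k))
    (ha : IsGog (m + 1) N k a) (hrow : ∀ j, 1 ≤ j → j ≤ min N k → a N j = l j) :
    IsGog m (N + 1) k (appendRow N k c a) := by
  rw [mem_interlacing] at hl
  obtain ⟨hl1, -, -⟩ := hl
  obtain ⟨a1, a2, a3, a4, a5⟩ := ha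
  have hpos : ∀ j, 1 ≤ j → j ≤ min (N + 1) k → 1 ≤ c j := by
    intro j h1 h2
    have := hc (j - 1) (by omega)
    rw [Nat.sub_add_cancel h1] at this
    omega
  refine ⟨?_, ?_, ?_, ?_, ?_⟩
  · rintro i j ⟨h1, h2, h3, h4, h5⟩
    by_cases hi : i = N + 1
    · subst hi
      have hp := hpos j h3 (by omega)
      have hq := hb j (by omega)
      rw [appendRow, if_pos rfl, if_pos ⟨h3, by omega⟩]
      omega
    · have := a1 i j ⟨h1, by omega, h3, h4, h5⟩
      rw [appendRow, if_neg hi]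
      omega
  · rintro i j ⟨h1, h2, h3, h4, h5⟩ ⟨-, h6, -⟩
    have hi : i ≠ N + 1 := by omega
    rw [appendRow, appendRow, if_neg hi]
    by_cases hiN : i = N
    · subst hiN
      rw [if_pos rfl, if_pos ⟨h3, by omega⟩, hrow j h3 (by omega)]
      have := (hl1 j h3 (by omega)).1
      rw [padConst, if_pos (by omega)] at this
      exact_mod_cast this
    · rw [if_neg (by omega)]
      exact a2 i j ⟨h1, by omega, h3, h4, h5⟩ ⟨by omega, by omega, h3, by omega, h5⟩
  · rintro i j ⟨h1, h2, h3, h4, h5⟩ ⟨-, h6, -, -, h7⟩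
    have hi : i ≠ N + 1 := by omega
    rw [appendRow, appendRow, if_neg hi]
    by_cases hiN : i = N
    · subst hiN
      rw [if_pos rfl, if_pos ⟨by omega, by omega⟩, hrow j h3 (by omega)]
      have := (hl1 j h3 (by omega)).2
      rw [padConst, if_pos (by omega)] at this
      exact_mod_cast this
    · rw [if_neg (by omega)]
      exact a3 i j ⟨h1, by omega, h3, h4, h5⟩ ⟨by omega, by omega, by omega, by omega, h7⟩
  · rintro i j ⟨h1, h2, h3, h4, h5⟩ ⟨-, -, -, h6, h7⟩
    by_cases hi : i = N + 1
    · subst hi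
      rw [appendRow, appendRow, if_pos rfl, if_pos ⟨h3, by omega⟩, if_pos rfl,
        if_pos ⟨by omega, by omega⟩]
      exact_mod_cast hc j (by omega)
    · rw [appendRow, appendRow, if_neg hi, if_neg hi]
      exact a4 i j ⟨h1, by omega, h3, h4, h5⟩ ⟨h1, by omega, by omega, h6, h7⟩
  · intro i j h
    by_cases hi : i = N + 1
    · subst hi
      rw [appendRow, if_pos rfl, if_neg]
      rintro ⟨h1, h2⟩
      exact h ⟨by omega, le_rfl, h1, by omega, by omega⟩
    · rw [appendRow, if_neg hi]
      apply a5
      rintro ⟨h1, h2, h3⟩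
      exact h ⟨h1, by omega, h3⟩

theorem exists_eq_appendRow {m N k : ℕ} {c : ℕ → ℕ} {a : ℕ → ℕ → ℤ}
    (ha : IsGog m (N + 1) k a) (hrow : ∀ j, 1 ≤ j → j ≤ min (N + 1) k → a (N + 1) j = c j) :
    ∃ l ∈ interlacing (padConst (min (N + 1) k) (m + k + 1) c) (min N k),
      ∃ b, IsGog (m + 1) N k b ∧ (∀ j, 1 ≤ j → j ≤ min N k → b N j = l j) ∧
        appendRow N k c b = a := by
  obtain ⟨a1, a2, a3, a4, a5⟩ := ha
  have hnat : ∀ j, 1 ≤ j → j ≤ min N k → ((a N j).toNat : ℤ) = a N j := by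
    intro j h1 h2
    have := (a1 N j ⟨by omega, by omega, h1, by omega, by omega⟩).1
    omega
  refine ⟨fun j => if 1 ≤ j ∧ j ≤ min N k then (a N j).toNat else 0, ?_,
    fun i j => if i = N + 1 then 0 else a i j, ⟨?_, ?_, ?_, ?_, ?_⟩, ?_, ?_⟩
  · rw [mem_interlacing]
    refine ⟨?_, ?_, ?_⟩
    · intro j h1 h2
      have hN := hnat j h1 h2
      have e1 := a2 N j ⟨by omega, by omega, h1, by omega, by omega⟩
        ⟨by omega, by omega, h1, by omega, by omega⟩
      rw [hrow j h1 (by omega)] at e1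
      rw [if_pos ⟨h1, h2⟩, padConst, if_pos (by omega), padConst]
      refine ⟨by omega, ?_⟩
      split_ifs with h
      · have e2 := a3 N j ⟨by omega, by omega, h1, by omega, by omega⟩
          ⟨by omega, by omega, by omega, by omega, by omega⟩
        rw [hrow (j + 1) (by omega) h] at e2
        omega
      · have e2 := (a1 N j ⟨by omega, by omega, h1, by omega, by omega⟩).2
        omega
    · intro j h
      rw [if_pos (show 1 ≤ j + 1 ∧ j + 1 ≤ min N k from ⟨by omega, h⟩)]
      have hN := hnat (j + 1) (by omega) h
      have e1 := (a1 N (j + 1) ⟨by omega, by omega, by omega, by omega, by omega⟩).1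
      split_ifs with h1
      · have e2 := a4 N j ⟨by omega, by omega, by omega, by omega, by omega⟩
          ⟨by omega, by omega, by omega, by omega, by omega⟩
        have := hnat j (by omega) (by omega)
        omega
      · omega
    · intro j h
      exact if_neg h
  · rintro i j ⟨h1, h2, h3⟩
    have := a1 i j ⟨h1, by omega, h3⟩
    dsimp only
    rw [if_neg (by omega)]
    omega
  · rintro i j ⟨h1, h2, h3⟩ ⟨h4, h5, h6⟩
    dsimp only
    rw [if_neg (by omega), if_neg (by omega)]
    exact a2 i j ⟨h1, by omega, h3⟩ ⟨h4, by omega, h6⟩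
  · rintro i j ⟨h1, h2, h3⟩ ⟨h4, h5, h6⟩
    dsimp only
    rw [if_neg (by omega), if_neg (by omega)]
    exact a3 i j ⟨h1, by omega, h3⟩ ⟨h4, by omega, h6⟩
  · rintro i j ⟨h1, h2, h3⟩ ⟨h4, h5, h6⟩
    dsimp only
    rw [if_neg (by omega), if_neg (by omega)]
    exact a4 i j ⟨h1, by omega, h3⟩ ⟨h4, by omega, h6⟩
  · intro i j h
    dsimp only
    split_ifs with hi
    · rfl
    · apply a5
      rintro ⟨h1, h2, h3⟩
      exact h ⟨h1, by omega, h3⟩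
  · intro j h1 h2
    dsimp only
    rw [if_neg (by omega), if_pos ⟨h1, h2⟩, hnat j h1 h2]
  · funext i j
    unfold appendRow
    split_ifs with hi hj
    · rw [hi, hrow j hj.1 hj.2]
    · symm
      apply a5
      rintro ⟨h1, h2, h3, h4, h5⟩
      exact hj ⟨h3, by omega⟩
    · exact if_neg hi

theorem isGog_zero_iff (m k : ℕ) (a : ℕ → ℕ → ℤ) : IsGog m 0 k a ↔ a = 0 := by
  have h : ∀ i j, ¬ GogPos 0 k i j := by
    rintro i j ⟨h1, h2, -⟩
    omega
  constructor
  · rintro ⟨-, -, -, -, h5⟩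
    funext i j
    exact h5 i j (h i j)
  · rintro rfl
    exact ⟨fun i j hp => (h i j hp).elim, fun i j hp => (h i j hp).elim,
      fun i j hp => (h i j hp).elim, fun i j hp => (h i j hp).elim, fun _ _ _ => rfl⟩

theorem gogDeg_zero : gogDeg 0 0 = 0 := by
  ext i
  rw [gogDeg_apply]
  split_ifs <;> rfl

/-- The Gog trapezoids with a prescribed bottom row are counted by a constant term. -/
theorem exists_finset_isGog (N k : ℕ) : ∀ (m : ℕ) (c : ℕ → ℕ),
    (∀ i, i < min N k → c i < c (i + 1)) → (∀ j, j ≤ min N k → c j ≤ m + j) →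
    ∃ S : Finset (ℕ → ℕ → ℤ),
      (∀ a, a ∈ S ↔ IsGog m N k a ∧ ∀ j, 1 ≤ j → j ≤ min N k → a N j = c j) ∧
      (S.card : ℚ) = coeff (gogDeg N (min N k))
        (gogPoly N (padConst (min N k) (m + k + 1) c)) := by
  classical
  induction N with
  | zero =>
    intro m c _ _
    refine ⟨{0}, ?_, ?_⟩
    · intro a
      rw [isGog_zero_iff, mem_singleton]
      exact ⟨fun h => ⟨h, by omega⟩, fun h => h.1⟩
    · simp [gogDeg_zero, gogPoly, pairProd]
  | succ N ih =>
    intro m c hc hb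
    set C := padConst (min (N + 1) k) (m + k + 1) c
    have hCle : ∀ i, i ≤ min (N + 1) k → C i = c i := fun i hi => if_pos hi
    have hCgt : ∀ i, min (N + 1) k < i → C i = m + k + 1 := fun i hi => if_neg (by omega)
    have hCmono : ∀ i, i ≤ min N k → C i < C (i + 1) := by
      intro i hi
      rw [hCle i (by omega)]
      by_cases h : i + 1 ≤ min (N + 1) k
      · rw [hCle _ h]
        exact hc i (by omega)
      · rw [hCgt _ (by omega)]
        have := hb i (by omega)
        omega
    have hS : ∀ l ∈ interlacing C (min N k), ∃ S : Finset (ℕ → ℕ → ℤ),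
        (∀ a, a ∈ S ↔ IsGog (m + 1) N k a ∧ ∀ j, 1 ≤ j → j ≤ min N k → a N j = l j) ∧
        (S.card : ℚ) = coeff (gogDeg N (min N k))
          (gogPoly N (padConst (min N k) (m + 1 + k + 1) l)) := by
      intro l hl
      rw [mem_interlacing] at hl
      obtain ⟨h1, h2, h3⟩ := hl
      refine ih (m + 1) l h2 ?_
      intro j hj
      by_cases hj0 : j = 0
      · rw [hj0, h3 0 (by omega)]
        omega
      · refine (h1 j (by omega) hj).2.trans ?_
        by_cases h : j + 1 ≤ min (N + 1) k
        · rw [hCle _ h]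
          have := hb (j + 1) h
          omega
        · rw [hCgt _ (by omega)]
          omega
    choose! S hSmem hScard using hS
    refine ⟨(interlacing C (min N k)).biUnion fun l => (S l).image (appendRow N k c), ?_, ?_⟩
    · intro a
      simp only [mem_biUnion, mem_image]
      constructor
      · rintro ⟨l, hl, b, hb', rfl⟩
        rw [hSmem l hl] at hb'
        refine ⟨isGog_appendRow hc hb hl hb'.1 hb'.2, ?_⟩
        intro j h1 h2
        rw [appendRow, if_pos rfl, if_pos ⟨h1, h2⟩]
      · rintro ⟨ha, hrow⟩
        obtain ⟨l, hl, b, hb1, hb2, hb3⟩ := exists_eq_appendRow ha hrow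
        exact ⟨l, hl, b, (hSmem l hl b).2 ⟨hb1, hb2⟩, hb3⟩
    · have hagree : ∀ b b', appendRow N k c b = appendRow N k c b' →
          ∀ i j, i ≠ N + 1 → b i j = b' i j := by
        intro b b' h i j hi
        have := congrFun (congrFun h i) j
        rwa [appendRow, appendRow, if_neg hi, if_neg hi] at this
      rw [card_biUnion]
      · rw [Nat.cast_sum]
        have hdeg : gogDeg (N + 1) (min (N + 1) k) = gogDeg (N + 1) (min N k) := by
          by_cases h : k ≤ N
          · rw [min_eq_right h, min_eq_right (by omega)]
          · rw [min_eq_left (by omega), min_eq_left (by omega), gogDeg_succ_self]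
        rw [hdeg, ← sum_coeff_interlacing N (min N k) (min_le_left _ _) C
          hCmono]
        refine sum_congr rfl fun l hl => ?_
        rw [card_image_of_injOn, hScard l hl]
        · congr 1
          unfold gogPoly
          congr 1
          refine prod_congr rfl fun i hi => ?_
          rw [mem_Icc] at hi
          congr 1
          unfold padConst
          dsimp only
          split_ifs with h
          · rfl
          · rw [hCgt (i + 1) (by omega)]
            omega
        · intro b hb1 b' hb2 h
          rw [mem_coe, hSmem l hl] at hb1 hb2
          funext i j
          by_cases hi : i = N + 1
          · have hp : ¬ GogPos N k i j := by
              rintro ⟨_, h2, _⟩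
              omega
            rw [hb1.1.2.2.2.2 i j hp, hb2.1.2.2.2.2 i j hp]
          · exact hagree b b' h i j hi
      · intro l hl l' hl' hne
        refine disjoint_left.2 ?_
        intro a ha ha'
        simp only [mem_image] at ha ha'
        obtain ⟨b, hb1, hb2⟩ := ha
        obtain ⟨b', hb1', hb2'⟩ := ha'
        rw [hSmem l hl] at hb1
        rw [hSmem l' hl'] at hb1'
        apply hne
        rw [mem_coe, mem_interlacing] at hl hl'
        funext j
        by_cases hj : 1 ≤ j ∧ j ≤ min N k
        · have e := hagree b b' (hb2.trans hb2'.symm) N j (by omega)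
          rw [hb1.2 j hj.1 hj.2, hb1'.2 j hj.1 hj.2] at e
          exact_mod_cast e
        · rw [hl.2.2 j hj, hl'.2.2 j hj]

theorem IsGog.bottom_row {n k : ℕ} (hkn : k ≤ n) {a : ℕ → ℕ → ℤ} (ha : IsGog 0 n k a) :
    ∀ j, 1 ≤ j → j ≤ k → a n j = j := by
  intro j
  induction j with
  | zero => omega
  | succ j ih =>
    intro _ hj
    obtain ⟨a1, -, -, a4, -⟩ := ha
    have e1 := a1 n (j + 1) ⟨by omega, le_rfl, by omega, by omega, hj⟩
    rcases Nat.eq_zero_or_pos j with rfl | hj0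
    · push_cast at *
      omega
    · have e2 := ih hj0 (by omega)
      have e3 := a4 n j ⟨by omega, le_rfl, by omega, by omega, by omega⟩
        ⟨by omega, le_rfl, by omega, by omega, hj⟩
      push_cast at *
      omega

end GogConstantTerm

/-- Every `(0,n,k)`-Gog trapezoid has bottom row `(1,2,…,k)`, and the number of
`(0,n,k)`-Gog trapezoids is the constant term of
`∏_{i=1}^k (1+x_i)^{i} x_i^{−n+1} ∏_{i=k+1}^n (1+x_i)^{k+1} x_i^{−n+i−k}
 ∏_{1≤i<j≤n} (x_i−x_j)(1+x_j+x_i x_j)`. -/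
theorem stmt6 (n k : ℕ) (hk : 1 ≤ k) (hkn : k ≤ n) :
    (∀ a : ℕ → ℕ → ℤ, IsGog 0 n k a → ∀ j ∈ Finset.Icc 1 k, a n j = (j : ℤ)) ∧
    (Set.ncard {a : ℕ → ℕ → ℤ | IsGog 0 n k a} : ℚ) =
    MvPolynomial.coeff (gogDeg n k)
      ((∏ i ∈ Finset.Icc 1 k, (1 + MvPolynomial.X i) ^ i) *
        (∏ i ∈ Finset.Icc (k+1) n, (1 + MvPolynomial.X i) ^ (k + 1)) *
        ∏ p ∈ (Finset.Icc 1 n ×ˢ Finset.Icc 1 n).filter (fun p => p.1 < p.2),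
          ((MvPolynomial.X p.1 - MvPolynomial.X p.2) *
            (1 + MvPolynomial.X p.2 + MvPolynomial.X p.1 * MvPolynomial.X p.2) :
            MvPolynomial ℕ ℚ)) := by
  refine ⟨fun a ha j hj => ?_, ?_⟩
  · rw [Finset.mem_Icc] at hj
    exact ha.bottom_row hkn j hj.1 hj.2
  · obtain ⟨S, hS, hcard⟩ := exists_finset_isGog n k 0 (fun i => i)
      (fun i _ => Nat.lt_succ_self i) (fun j _ => (Nat.zero_add j).ge)
    rw [min_eq_right hkn] at hS hcard
    have hset : {a : ℕ → ℕ → ℤ | IsGog 0 n k a} = S := by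
      ext a
      rw [Set.mem_ofPred_eq, Finset.mem_coe, hS]
      exact ⟨fun h => ⟨h, h.bottom_row hkn⟩, fun h => h.1⟩
    rw [hset, Set.ncard_coe_finset, hcard, gogPoly, pairProd_eq_prod_filter,
      prod_Icc_split n k hkn]
    refine congrArg _ (congrArg (· * _) (congrArg₂ (· * ·) ?_ ?_))
    · refine Finset.prod_congr rfl fun i hi => ?_
      rw [Finset.mem_Icc] at hi
      rw [padConst, if_pos hi.2]
    · refine Finset.prod_congr rfl fun i hi => ?_
      rw [Finset.mem_Icc] at hi
      rw [padConst, if_neg (by omega), Nat.zero_add]
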